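/- arXiv:1512.08320 — 5 statements merged into one kernel-verified Lean document; each statement's English description precedes it below -/
import Mathlib

section
/- Let X be a topological space and f : X → ℝ. Then f is quasicontinuous if and only if for every open set G ⊆ X and every set A ⊆ G that is dense in G, one has f(G) ⊆ closure(f(A)). -/
/-- A function `f : X → ℝ` is quasicontinuous if for every point `x`, every
neighborhood `U` of `x` and every `ε > 0` there is a nonempty open set `V ⊆ U`
on which `f` is `ε`-close to `f x`. -/
def QuasiContinuous {X : Type*} [TopologicalSpace X] (f : X → ℝ) : Prop :=
  ∀ x : X, ∀ U ∈ nhds x, ∀ ε : ℝ, 0 < ε →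
    ∃ V : Set X, IsOpen V ∧ V.Nonempty ∧ V ⊆ U ∧ ∀ v ∈ V, |f v - f x| < ε

theorem quasicontinuous_iff_image_subset_closure_image_dense
    {X : Type*} [TopologicalSpace X] (f : X → ℝ) :
    QuasiContinuous f ↔
      ∀ G : Set X, IsOpen G → ∀ A : Set X, A ⊆ G → G ⊆ closure A →
        f '' G ⊆ closure (f '' A) := by
  constructor
  · rintro hf G hG A - hGA _ ⟨x, hx, rfl⟩
    refine Metric.mem_closure_iff.2 fun ε hε => ?_
    obtain ⟨V, hV, ⟨v, hv⟩, hVG, hVf⟩ := hf x G (hG.mem_nhds hx) ε hε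
    obtain ⟨a, haV, haA⟩ := mem_closure_iff.1 (hGA (hVG hv)) V hV hv
    refine ⟨f a, Set.mem_image_of_mem f haA, ?_⟩
    rw [dist_comm, Real.dist_eq]
    exact hVf a haV
  · intro h x U hU ε hε
    by_contra! hV
    have hdense : interior U ⊆ closure {v ∈ interior U | ε ≤ |f v - f x|} := by
      refine fun y hy => mem_closure_iff.2 fun O hO hyO => ?_
      obtain ⟨v, hv, hvε⟩ := hV (O ∩ interior U) (hO.inter isOpen_interior) ⟨y, hyO, hy⟩
        (Set.inter_subset_right.trans interior_subset)
      exact ⟨v, hv.1, hv.2, hvε⟩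
    have hx := h (interior U) isOpen_interior _ (Set.sep_subset _ _) hdense
      (Set.mem_image_of_mem f (mem_interior_iff_mem_nhds.2 hU))
    obtain ⟨_, ⟨a, ha, rfl⟩, hdist⟩ := Metric.mem_closure_iff.1 hx ε hε
    rw [dist_comm, Real.dist_eq] at hdist
    exact hdist.not_ge ha.2
end

section
/- Let X be a topological space and f : X → ℝ a quasicontinuous function. Then for every open set G ⊆ X and every set A ⊆ G dense in G, the oscillation of f on G is at most the oscillation of f on A, i.e. ω_f(G) ≤ ω_f(A). -/
open scoped ENNReal

/-- The oscillation `ω_f(A) = sup {|f x' - f x''| : x', x'' ∈ A}`,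
as an element of `[0, +∞]`. -/
noncomputable def osc {X : Type*} (f : X → ℝ) (A : Set X) : ℝ≥0∞ :=
  ⨆ x ∈ A, ⨆ y ∈ A, ENNReal.ofReal |f x - f y|

/-- Values of a quasicontinuous function on an open set are approximated by its values on any
subset dense in that open set. -/
theorem QuasiContinuous.exists_mem_abs_sub_lt {X : Type*} [TopologicalSpace X] {f : X → ℝ}
    (hf : QuasiContinuous f) {G A : Set X} (hG : IsOpen G) (hGA : G ⊆ closure A) {x : X}
    (hx : x ∈ G) {ε : ℝ} (hε : 0 < ε) : ∃ a ∈ A, |f a - f x| < ε := by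
  obtain ⟨V, hV, ⟨v, hv⟩, hVG, hVf⟩ := hf x G (hG.mem_nhds hx) ε hε
  obtain ⟨a, haV, haA⟩ := mem_closure_iff.1 (hGA (hVG hv)) V hV hv
  exact ⟨a, haA, hVf a haV⟩

theorem osc_le_osc_of_dense {X : Type*} [TopologicalSpace X] (f : X → ℝ)
    (hf : QuasiContinuous f) :
    ∀ G : Set X, IsOpen G → ∀ A : Set X, A ⊆ G → G ⊆ closure A →
      osc f G ≤ osc f A := by
  intro G hG A _ hGA
  refine iSup₂_le fun x hx => iSup₂_le fun y hy => ?_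
  refine ENNReal.le_of_forall_pos_le_add fun ε hε _ => ?_
  have hε' : (0 : ℝ) < ε / 2 := half_pos (NNReal.coe_pos.2 hε)
  obtain ⟨a, ha, hax⟩ := hf.exists_mem_abs_sub_lt hG hGA hx hε'
  obtain ⟨b, hb, hby⟩ := hf.exists_mem_abs_sub_lt hG hGA hy hε'
  have hxy : |f x - f y| ≤ |f a - f b| + ε := by
    have h₁ := abs_sub_le (f x) (f a) (f y)
    have h₂ := abs_sub_le (f a) (f b) (f y)
    rw [abs_sub_comm (f x) (f a)] at h₁
    linarith
  calc ENNReal.ofReal |f x - f y|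
      ≤ ENNReal.ofReal (|f a - f b| + ε) := ENNReal.ofReal_le_ofReal hxy
    _ ≤ ENNReal.ofReal |f a - f b| + ENNReal.ofReal ε := ENNReal.ofReal_add_le
    _ = ENNReal.ofReal |f a - f b| + ε := by rw [ENNReal.ofReal_coe_nnreal]
    _ ≤ osc f A + ε := by
      gcongr
      exact (le_iSup₂ (f := fun y (_ : y ∈ A) => ENNReal.ofReal |f a - f y|) b hb).trans
        (le_iSup₂ (f := fun x (_ : x ∈ A) => ⨆ y ∈ A, ENNReal.ofReal |f x - f y|) a ha)
end

section
/- Let X = X₁ × ⋯ × X_n be a product of n topological spaces, let 𝒲 be a locally finite family of nonempty open subsets of X, and for each W ∈ 𝒲 let f_W : X → ℝ be a lower semicontinuous, separately continuous function with f_W(x) = 0 for all x ∈ X \ W. Then the pointwise sum f(x) = Σ_{W ∈ 𝒲} f_W(x) is a well-defined lower semicontinuous function on X, and its set of discontinuity points satisfies D(f) = ⋃_{W ∈ 𝒲} D(f_W). -/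
/-- A function on a product of `n` topological spaces is separately continuous
if it is continuous in each variable when the other variables are fixed. -/
def SeparatelyContinuous {n : ℕ} {X : Fin n → Type*} [∀ i, TopologicalSpace (X i)]
    (f : (∀ i, X i) → ℝ) : Prop :=
  ∀ (k : Fin n) (x : ∀ i, X i), Continuous fun t : X k => f (Function.update x k t)

open Filter Topology

section LocallyFiniteSum

variable {ι Y : Type*} [TopologicalSpace Y]

/-- Near any point, the sum of a locally finitely supported family is a finite sum, and the index
set may be chosen to contain any prescribed index set. -/
theorem exists_finset_eventually_tsum_eq_sum {W : ι → Set Y} (hW : LocallyFinite W)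
    {f : ι → Y → ℝ} (hf : ∀ i, ∀ x ∉ W i, f i x = 0) (t : Finset ι) (x : Y) :
    ∃ s : Finset ι, t ⊆ s ∧
      (fun y => ∑' i, f i y) =ᶠ[𝓝 x] fun y => ∑ i ∈ s, f i y := by
  classical
  obtain ⟨U, hU, hfin⟩ := hW x
  refine ⟨t ∪ hfin.toFinset, Finset.subset_union_left, ?_⟩
  filter_upwards [hU] with y hy
  refine tsum_eq_sum fun i hi => hf i y fun hyW => hi ?_
  exact Finset.mem_union_right _ (hfin.mem_toFinset.2 ⟨y, hyW, hy⟩)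

theorem LowerSemicontinuousAt.of_eventuallyEq {f g : Y → ℝ} {x : Y}
    (hf : LowerSemicontinuousAt f x) (h : f =ᶠ[𝓝 x] g) : LowerSemicontinuousAt g x := by
  intro a ha
  have hax : a < f x := h.eq_of_nhds.symm ▸ ha
  filter_upwards [hf a hax, h] with y hy hfg
  exact hfg ▸ hy

/-- If a sum of two functions lower semicontinuous at a point is continuous there,
then so is the first summand. -/
theorem ContinuousAt.of_add_of_lowerSemicontinuousAt {f g : Y → ℝ} {x : Y}
    (h : ContinuousAt (fun y => f y + g y) x) (hf : LowerSemicontinuousAt f x)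
    (hg : LowerSemicontinuousAt g x) : ContinuousAt f x := by
  refine continuousAt_iff_lower_upperSemicontinuousAt.2 ⟨hf, fun a ha => ?_⟩
  have hε : 0 < (a - f x) / 2 := by linarith
  filter_upwards [h.eventually_lt_const (lt_add_of_pos_right (f x + g x) hε),
    hg (g x - (a - f x) / 2) (by linarith)] with y hy hgy
  linarith

end LocallyFiniteSum

theorem lsc_sum_locallyFinite_discontinuity
    {n : ℕ} {X : Fin n → Type*} [∀ i, TopologicalSpace (X i)]
    {ι : Type*} (W : ι → Set (∀ i, X i))
    (hWlf : LocallyFinite W) (hWopen : ∀ i, IsOpen (W i)) (hWne : ∀ i, (W i).Nonempty)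
    (f : ι → (∀ i, X i) → ℝ)
    (hlsc : ∀ i, LowerSemicontinuous (f i))
    (hsep : ∀ i, SeparatelyContinuous (f i))
    (hzero : ∀ i, ∀ x ∉ W i, f i x = 0) :
    (∀ x, Summable fun i => f i x) ∧
    LowerSemicontinuous (fun x => ∑' i, f i x) ∧
    {x | ¬ ContinuousAt (fun x => ∑' i, f i x) x} =
      ⋃ i, {x | ¬ ContinuousAt (f i) x} := by
  have hsum := exists_finset_eventually_tsum_eq_sum hWlf hzero
  refine ⟨fun x => ?_, fun x => ?_, ?_⟩
  · refine summable_of_hasFiniteSupport ((hWlf.point_finite x).subset fun i hi => ?_)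
    by_contra hx
    exact hi (hzero i x hx)
  · obtain ⟨s, -, hs⟩ := hsum ∅ x
    exact (lowerSemicontinuousAt_sum fun i _ => hlsc i x).of_eventuallyEq hs.symm
  · classical
    ext x
    simp only [Set.mem_ofPred_eq, Set.mem_iUnion, ← not_forall, not_iff_not]
    constructor
    · intro hx i
      obtain ⟨s, his, hs⟩ := hsum {i} x
      have hi : i ∈ s := Finset.singleton_subset_iff.1 his
      have hadd : ContinuousAt (fun y => f i y + ∑ j ∈ s.erase i, f j y) x := by
        exact (hx.congr hs).congr (.of_forall fun y => (Finset.add_sum_erase s (f · y) hi).symm)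
      exact hadd.of_add_of_lowerSemicontinuousAt (hlsc i x)
        (lowerSemicontinuousAt_sum fun j _ => hlsc j x)
    · intro hx
      obtain ⟨s, -, hs⟩ := hsum ∅ x
      exact ContinuousAt.congr (tendsto_finsetSum s fun i _ => hx i) hs.symm
end

section
/- Let X₁, …, X_n be metrizable topological spaces, X = X₁ × ⋯ × X_n, and f : X → ℝ a separately continuous function. Then the set D(f) of discontinuity points of f is the union of a sequence (E_m)_{m≥1} of F_σ subsets of X each of which is locally projectively meager. -/
/-- The projection of the product `X₁ × ⋯ × Xₙ` omitting the `k`-th coordinate. -/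
def projHat {n : ℕ} {X : Fin n → Type*} (k : Fin n) (x : ∀ i, X i) :
    ∀ i : {i : Fin n // i ≠ k}, X i.1 :=
  fun i => x i.1

/-- A set `A` in a product is projectively meager with respect to the `k`-th
variable if its projection omitting the `k`-th coordinate is meager. -/
def ProjectivelyMeagerWrt {n : ℕ} {X : Fin n → Type*} [∀ i, TopologicalSpace (X i)]
    (k : Fin n) (A : Set (∀ i, X i)) : Prop :=
  IsMeagre (projHat k '' A)

/-- `A` is locally projectively meager with respect to the `k`-th variable if every
point has a neighborhood `U` such that `A ∩ U` is projectively meager w.r.t. `k`. -/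
def LocallyProjectivelyMeagerWrt {n : ℕ} {X : Fin n → Type*} [∀ i, TopologicalSpace (X i)]
    (k : Fin n) (A : Set (∀ i, X i)) : Prop :=
  ∀ x : ∀ i, X i, ∃ U ∈ nhds x, ProjectivelyMeagerWrt k (A ∩ U)

/-- `A` is locally projectively meager if it is locally projectively meager with
respect to every variable. -/
def LocallyProjectivelyMeager {n : ℕ} {X : Fin n → Type*} [∀ i, TopologicalSpace (X i)]
    (A : Set (∀ i, X i)) : Prop :=
  ∀ k : Fin n, LocallyProjectivelyMeagerWrt k A

/-- A set `A` in a product is projectively nowhere dense with respect to the `k`-th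
variable if its projection omitting the `k`-th coordinate is nowhere dense. -/
def ProjectivelyNowhereDenseWrt {n : ℕ} {X : Fin n → Type*} [∀ i, TopologicalSpace (X i)]
    (k : Fin n) (A : Set (∀ i, X i)) : Prop :=
  IsNowhereDense (projHat k '' A)

/-- `A` is locally projectively nowhere dense with respect to the `k`-th variable if
every point has a neighborhood `U` such that `A ∩ U` is projectively nowhere dense
w.r.t. `k`. -/
def LocallyProjectivelyNowhereDenseWrt {n : ℕ} {X : Fin n → Type*}
    [∀ i, TopologicalSpace (X i)] (k : Fin n) (A : Set (∀ i, X i)) : Prop :=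
  ∀ x : ∀ i, X i, ∃ U ∈ nhds x, ProjectivelyNowhereDenseWrt k (A ∩ U)

/-- `A` is locally projectively nowhere dense if it is locally projectively nowhere
dense with respect to every variable. -/
def LocallyProjectivelyNowhereDense {n : ℕ} {X : Fin n → Type*}
    [∀ i, TopologicalSpace (X i)] (A : Set (∀ i, X i)) : Prop :=
  ∀ k : Fin n, LocallyProjectivelyNowhereDenseWrt k A

/-- An `F_σ` set is a countable union of closed sets. -/
def IsFsigma {X : Type*} [TopologicalSpace X] (s : Set X) : Prop :=
  ∃ F : ℕ → Set X, (∀ n, IsClosed (F n)) ∧ s = ⋃ n, F n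

open Set Filter Topology Metric

section Category

variable {Y : Type*} [TopologicalSpace Y]

lemma IsNowhereDense.union {s t : Set Y} (hs : IsNowhereDense s) (ht : IsNowhereDense t) :
    IsNowhereDense (s ∪ t) := by
  rw [IsNowhereDense, closure_union,
    interior_union_isClosed_of_interior_empty isClosed_closure ht]
  exact hs

lemma Set.Finite.isNowhereDense_biUnion {ι : Type*} {I : Set ι} (hI : I.Finite) {A : ι → Set Y}
    (hA : ∀ i ∈ I, IsNowhereDense (A i)) : IsNowhereDense (⋃ i ∈ I, A i) := by
  induction I, hI using Set.Finite.induction_on with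
  | empty => simp
  | insert _ _ ih =>
    rw [biUnion_insert]
    exact (hA _ (mem_insert _ _)).union (ih fun i hi => hA i (mem_insert_of_mem _ hi))

lemma IsClosed.isNowhereDense_of_local {s : Set Y} (hs : IsClosed s)
    (h : ∀ x, ∃ U ∈ 𝓝 x, IsNowhereDense (s ∩ U)) : IsNowhereDense s := by
  rw [hs.isNowhereDense_iff, eq_empty_iff_forall_notMem]
  intro x hx
  obtain ⟨U, hU, hsU⟩ := h x
  have hmem : closure (s ∩ U) ∈ 𝓝 x :=
    mem_of_superset (inter_mem (mem_interior_iff_mem_nhds.1 hx) hU) subset_closure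
  have hx' := mem_interior_iff_mem_nhds.2 hmem
  rw [hsU] at hx'
  exact hx'

lemma IsNowhereDense.preimage_of_isOpenMap {Z : Type*} [TopologicalSpace Z] {g : Z → Y}
    (hg : Continuous g) (ho : IsOpenMap g) {s : Set Y} (hs : IsNowhereDense s) :
    IsNowhereDense (g ⁻¹' s) := by
  have h : interior (g ⁻¹' closure s) = ∅ := by
    rw [← ho.preimage_interior_eq_interior_preimage hg, hs, preimage_empty]
  exact subset_empty_iff.1 (h ▸ interior_mono (hg.closure_preimage_subset s))

lemma IsMeagre.exists_isClosed_isNowhereDense {s : Set Y} (hs : IsMeagre s) :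
    ∃ N : ℕ → Set Y, (∀ i, IsClosed (N i)) ∧ (∀ i, IsNowhereDense (N i)) ∧ s ⊆ ⋃ i, N i := by
  obtain ⟨S, hS, hc, hsub⟩ := isMeagre_iff_countable_union_isNowhereDense.1 hs
  obtain ⟨g, hg⟩ := (hc.insert ∅).exists_eq_range (insert_nonempty _ _)
  refine ⟨fun i => closure (g i), fun i => isClosed_closure, fun i => ?_, ?_⟩
  · have hi : g i ∈ insert ∅ S := hg ▸ mem_range_self i
    rcases hi with hi | hi
    · simp [hi]
    · exact (hS _ hi).closure
  · intro x hx
    obtain ⟨t, ht, hxt⟩ := hsub hx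
    have : t ∈ range g := hg ▸ mem_insert_of_mem _ ht
    obtain ⟨i, rfl⟩ := this
    exact mem_iUnion.2 ⟨i, subset_closure hxt⟩

lemma LocallyFinite.isMeagre_iUnion_inter {ι : Type*} {C A : ι → Set Y} (hC : LocallyFinite C)
    (hCc : ∀ c, IsClosed (C c)) (hA : ∀ c, IsMeagre (A c)) : IsMeagre (⋃ c, C c ∩ A c) := by
  choose N hNc hNd hN using fun c => (hA c).exists_isClosed_isNowhereDense
  have hmeagre : IsMeagre (⋃ i, ⋃ c, C c ∩ N c i) := by
    refine isMeagre_iUnion fun i => IsNowhereDense.isMeagre ?_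
    have hcl : IsClosed (⋃ c, C c ∩ N c i) :=
      (hC.subset fun c => inter_subset_left).isClosed_iUnion fun c => (hCc c).inter (hNc c i)
    refine hcl.isNowhereDense_of_local fun x => ?_
    obtain ⟨U, hU, hfin⟩ := hC x
    refine ⟨U, hU, (hfin.isNowhereDense_biUnion fun c _ => hNd c i).mono ?_⟩
    rintro y ⟨hy, hyU⟩
    obtain ⟨c, hyC, hyN⟩ := mem_iUnion.1 hy
    exact mem_biUnion (show c ∈ {c | (C c ∩ U).Nonempty} from ⟨y, hyC, hyU⟩) hyN
  refine hmeagre.mono fun x hx => ?_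
  obtain ⟨c, hxC, hxA⟩ := mem_iUnion.1 hx
  obtain ⟨i, hi⟩ := mem_iUnion.1 (hN c hxA)
  exact mem_iUnion.2 ⟨i, mem_iUnion.2 ⟨c, hxC, hi⟩⟩

lemma exists_locallyFinite_isClosed_subset_ball (T : Type*) [PseudoMetricSpace T] {r : ℝ}
    (hr : 0 < r) :
    ∃ C : T → Set T, (∀ c, IsClosed (C c)) ∧ LocallyFinite C ∧ (∀ t, ∃ c, t ∈ C c) ∧
      ∀ c, C c ⊆ ball c r := by
  obtain ⟨v, -, hvc, hvf, hv⟩ := precise_refinement (fun c : T => ball c (r / 2))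
    (fun c => isOpen_ball) (iUnion_eq_univ_iff.2 fun t => ⟨t, mem_ball_self (half_pos hr)⟩)
  refine ⟨fun c => closure (v c), fun c => isClosed_closure, hvf.closure, fun t => ?_, fun c => ?_⟩
  · obtain ⟨c, hc⟩ := iUnion_eq_univ_iff.1 hvc t
    exact ⟨c, subset_closure hc⟩
  · exact (closure_minimal ((hv c).trans ball_subset_closedBall) isClosed_closedBall).trans
      (closedBall_subset_ball (half_lt_self hr))

/-- A metrizable space has a sequence of locally finite closed covers, each swollen to a family of
open sets, such that the swellings form a neighborhood base in the strong sense below. -/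
lemma exists_locallyFinite_closed_covers (T : Type*) [TopologicalSpace T]
    [TopologicalSpace.MetrizableSpace T] :
    ∃ C V : ℕ → T → Set T, (∀ j c, IsClosed (C j c)) ∧ (∀ j, LocallyFinite (C j)) ∧
      (∀ j c, IsOpen (V j c)) ∧ (∀ j c, C j c ⊆ V j c) ∧
      ∀ t, ∀ U ∈ 𝓝 t, ∃ j c, t ∈ C j c ∧ V j c ⊆ U := by
  let := TopologicalSpace.metrizableSpaceMetric T
  choose C hCc hCf hCu hCb using fun j : ℕ =>
    exists_locallyFinite_isClosed_subset_ball T (r := 1 / ((j : ℝ) + 1)) (by positivity)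
  refine ⟨C, fun j c => ball c (1 / ((j : ℝ) + 1)), hCc, hCf, fun _ _ => isOpen_ball, hCb, ?_⟩
  intro t U hU
  obtain ⟨δ, hδ, hδU⟩ := Metric.mem_nhds_iff.1 hU
  obtain ⟨j, hj⟩ := exists_nat_one_div_lt (half_pos hδ)
  obtain ⟨c, hc⟩ := hCu j t
  refine ⟨j, c, hc, fun s hs => hδU ?_⟩
  have h1 := mem_ball'.1 (hCb j c hc)
  have h2 := mem_ball.1 hs
  rw [mem_ball]
  linarith [dist_triangle s c t]

/-- The Banach category theorem for metrizable spaces. -/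
lemma isMeagre_sUnion_isOpen_isMeagre [TopologicalSpace.MetrizableSpace Y] :
    IsMeagre (⋃₀ {O : Set Y | IsOpen O ∧ IsMeagre O}) := by
  classical
  obtain ⟨C, V, hCc, hCf, -, hCV, hbase⟩ := exists_locallyFinite_closed_covers Y
  have h : IsMeagre (⋃ j, ⋃ c, C j c ∩ if IsMeagre (V j c) then V j c else ∅) := by
    refine isMeagre_iUnion fun j => (hCf j).isMeagre_iUnion_inter (hCc j) fun c => ?_
    split_ifs with hm
    · exact hm
    · exact IsMeagre.empty
  refine h.mono ?_
  rintro x ⟨O, ⟨hO, hOm⟩, hxO⟩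
  obtain ⟨j, c, hx, hsub⟩ := hbase x O (hO.mem_nhds hxO)
  refine mem_iUnion.2 ⟨j, mem_iUnion.2 ⟨c, hx, ?_⟩⟩
  rw [if_pos (hOm.mono hsub)]
  exact hCV j c hx

end Category

section Product

variable {T Y : Type*} [TopologicalSpace T] [TopologicalSpace Y]

/-- On open sets all of whose nonempty open subsets are nonmeager, an upper bound for `g` which
holds on a dense subset holds everywhere. -/
def BoundExtends (g : Y → ℝ) : Prop :=
  ∀ G, IsOpen G → (∀ O ⊆ G, IsOpen O → O.Nonempty → ¬ IsMeagre O) →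
    ∀ a, G ⊆ closure {y | g y ≤ a} → ∀ y ∈ G, g y ≤ a

lemma BoundExtends.comp_homeomorph {g : Y → ℝ} (hg : BoundExtends g) (e : T ≃ₜ Y) :
    BoundExtends (g ∘ e) := by
  intro G hG hGm a hGa x hx
  have h := hg (e.symm ⁻¹' G) (hG.preimage e.symm.continuous) ?_ a ?_ (e x) (by simpa using hx)
  · exact h
  · intro O hO hOo hOne hOm
    refine hGm (e ⁻¹' O) (fun t ht => by simpa using hO ht) (hOo.preimage e.continuous)
      (hOne.preimage e.surjective) (hOm.preimage_of_isOpenMap e.continuous e.isOpenMap)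
  · intro y hy
    have := hGa hy
    rw [← mem_preimage, e.symm.preimage_closure] at this
    simpa [preimage] using this

lemma BoundExtends.of_sections [FirstCountableTopology T] {f : T × Y → ℝ}
    (hf : ∀ y, Continuous fun t => f (t, y))
    (hle : ∀ t, BoundExtends fun y => f (t, y)) (hge : ∀ t, BoundExtends fun y => -f (t, y)) :
    BoundExtends f := by
  rintro G hG hGm b hGb ⟨t₀, y₀⟩ hx
  by_contra! hlt
  obtain ⟨T₁, Y₁, hT₁, hY₁, ht₀, hy₀, hsub⟩ := isOpen_prod_iff.1 hG t₀ y₀ hx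
  have hY₁m : ∀ O ⊆ Y₁, IsOpen O → O.Nonempty → ¬ IsMeagre O := by
    intro O hO hOo hOne hOm
    refine hGm (T₁ ×ˢ O) ((prod_mono_right hO).trans hsub) (hT₁.prod hOo)
      (Set.Nonempty.prod ⟨t₀, ht₀⟩ hOne) ?_
    exact (hOm.preimage_of_isOpenMap continuous_snd isOpenMap_snd).mono fun p hp => hp.2
  obtain ⟨a, hba, haf⟩ := exists_between hlt
  set H := Y₁ \ closure {y | f (t₀, y) ≤ a} with hH
  have hHo : IsOpen H := hY₁.sdiff isClosed_closure
  have hHne : H.Nonempty := by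
    by_contra hne
    rw [not_nonempty_iff_eq_empty, hH, sdiff_eq_empty] at hne
    exact absurd (hle t₀ Y₁ hY₁ hY₁m a hne y₀ hy₀) (not_le.2 haf)
  have hHa : ∀ y ∈ H, a < f (t₀, y) := fun y hy =>
    not_le.1 fun h => hy.2 (subset_closure h)
  obtain ⟨B, hB⟩ := (𝓝 t₀).exists_antitone_basis
  set D : ℕ → Set Y := fun m => {y | y ∈ H ∧ ∀ t ∈ B m, a ≤ f (t, y)} with hD
  have hHD : H ⊆ ⋃ m, D m := by
    intro y hy
    have : {t | a < f (t, y)} ∈ 𝓝 t₀ := (hf y).continuousAt.eventually_const_lt (hHa y hy)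
    obtain ⟨m, hm⟩ := hB.mem_iff.1 this
    exact mem_iUnion.2 ⟨m, hy, fun t ht => (hm ht).le⟩
  obtain ⟨m, hm⟩ : ∃ m, ¬ IsNowhereDense (D m) := by
    by_contra! h
    exact hY₁m H sdiff_subset hHo hHne
      ((isMeagre_iUnion fun m => (h m).isMeagre).mono hHD)
  obtain ⟨z, hz⟩ := nonempty_iff_ne_empty.2 hm
  obtain ⟨y₁, hy₁, hy₁D⟩ := mem_closure_iff.1 (interior_subset hz) _ isOpen_interior hz
  set H' := interior (closure (D m)) ∩ H with hH'
  have hH'o : IsOpen H' := isOpen_interior.inter hHo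
  have hlow : ∀ t ∈ B m, ∀ y ∈ H', a ≤ f (t, y) := by
    intro t ht y hy
    refine neg_le_neg_iff.1 (hge t H' hH'o (fun O hO => hY₁m O (hO.trans ?_)) (-a) ?_ y hy)
    · exact fun y hy => hy.2.1
    · exact fun y hy => closure_mono (fun z hz => neg_le_neg (hz.2 t ht)) (interior_subset hy.1)
  have ht₀B : t₀ ∈ interior (B m) := mem_interior_iff_mem_nhds.2 (hB.mem m)
  have hyG : (t₀, y₁) ∈ G := hsub ⟨ht₀, hy₁D.1.1⟩
  obtain ⟨⟨t, y⟩, ⟨ht, hy⟩, hty⟩ := mem_closure_iff.1 (hGb hyG) (interior (B m) ×ˢ H')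
    (isOpen_interior.prod hH'o) ⟨ht₀B, hy₁, hy₁D.1⟩
  exact absurd (hlow t (interior_subset ht) y hy) (not_le.2 (lt_of_le_of_lt hty hba))

/-- The oscillation of `f` at `x` is at most `ε`, in the sense that `f` varies by at most `ε` on a
neighborhood of `x`. -/
def SmallOscAt (f : Y → ℝ) (ε : ℝ) (x : Y) : Prop :=
  ∃ U ∈ 𝓝 x, ∀ y ∈ U, ∀ z ∈ U, |f y - f z| ≤ ε

lemma isClosed_not_smallOscAt (f : Y → ℝ) (ε : ℝ) : IsClosed {x | ¬ SmallOscAt f ε x} := by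
  rw [← isOpen_compl_iff, isOpen_iff_mem_nhds]
  intro x hx
  obtain ⟨U, hU, h⟩ := not_not.1 hx
  filter_upwards [eventually_mem_nhds_iff.2 hU] with y hy
  exact not_not.2 ⟨U, hy, h⟩

lemma ContinuousAt.smallOscAt {f : Y → ℝ} {x : Y} (h : ContinuousAt f x) {ε : ℝ} (hε : 0 < ε) :
    SmallOscAt f ε x := by
  refine ⟨f ⁻¹' ball (f x) (ε / 2), h (ball_mem_nhds _ (half_pos hε)), fun y hy z hz => ?_⟩
  have h1 := mem_ball.1 hy
  have h2 := mem_ball.1 hz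
  rw [← Real.dist_eq]
  linarith [dist_triangle_right (f y) (f z) (f x)]

lemma exists_not_smallOscAt {f : Y → ℝ} {x : Y} (h : ¬ ContinuousAt f x) {c : ℝ} (hc : 0 < c) :
    ∃ m : ℕ, ¬ SmallOscAt f (c * (1 / ((m : ℝ) + 1))) x := by
  contrapose! h
  rw [Metric.continuousAt_iff']
  intro ε hε
  obtain ⟨m, hm⟩ := exists_nat_one_div_lt (div_pos hε hc)
  obtain ⟨U, hU, hUm⟩ := h m
  filter_upwards [hU] with y hy
  rw [lt_div_iff₀' hc] at hm
  exact (hUm y hy x (mem_of_mem_nhds hU)).trans_lt hm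

lemma isMeagre_not_smallOscAt_of_sections [TopologicalSpace.MetrizableSpace Y] {f : T × Y → ℝ}
    (hcont : ∀ t, IsMeagre {y | ¬ ContinuousAt (fun y => f (t, y)) y})
    (hext : ∀ s t, BoundExtends fun y => f (s, y) - f (t, y))
    {V : Set T} (hV : IsOpen V) {ε : ℝ} (hε : 0 < ε) :
    IsMeagre {y | (∀ s ∈ V, ∀ t ∈ V, f (s, y) - f (t, y) ≤ ε) ∧
      ∃ t ∈ V, ¬ SmallOscAt f (4 * ε) (t, y)} := by
  rcases V.eq_empty_or_nonempty with rfl | ⟨t₀, ht₀⟩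
  · simpa using IsMeagre.empty
  set A := {y | ∀ s ∈ V, ∀ t ∈ V, f (s, y) - f (t, y) ≤ ε} with hA
  set Z := ⋃₀ {O : Set Y | IsOpen O ∧ IsMeagre O} with hZ
  have hZo : IsOpen Z := isOpen_sUnion fun O hO => hO.1
  have hZm : IsMeagre Z := isMeagre_sUnion_isOpen_isMeagre
  set G := interior (closure A) \ closure Z with hG
  have hGo : IsOpen G := isOpen_interior.sdiff isClosed_closure
  have hGA : ∀ s ∈ V, ∀ t ∈ V, ∀ y ∈ G, f (s, y) - f (t, y) ≤ ε := by
    intro s hs t ht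
    refine hext s t G hGo (fun O hO hOo ⟨y, hy⟩ hOm => ?_) ε fun y hy =>
      closure_mono (fun z (hz : z ∈ A) => hz s hs t ht) (interior_subset hy.1)
    exact (hO hy).2 (subset_closure ⟨O, ⟨hOo, hOm⟩, hy⟩)
  have hA' : IsMeagre (A \ interior (closure A)) := by
    refine IsNowhereDense.isMeagre (IsNowhereDense.mono
      (s := closure A \ interior (closure A)) (sdiff_subset_sdiff_left subset_closure) ?_)
    rw [← isClosed_closure.frontier_eq]
    exact isClosed_frontier.isNowhereDense_iff.2 (interior_frontier isClosed_closure)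
  have hZ' : IsMeagre (closure Z) := by
    refine IsMeagre.mono (s := Z ∪ frontier Z) ?_ (hZm.union ?_)
    · rw [← closure_eq_self_union_frontier]
    · refine IsNowhereDense.isMeagre (isClosed_frontier.isNowhereDense_iff.2 ?_)
      rw [← frontier_compl]
      exact interior_frontier hZo.isClosed_compl
  refine ((hA'.union hZ').union (hcont t₀)).mono ?_
  rintro y ⟨hyA, t, ht, hosc⟩
  by_contra hy
  simp only [mem_union, not_or, Set.mem_sdiff, not_and, not_not, mem_ofPred_eq] at hy
  obtain ⟨⟨hy1, hy2⟩, hy3⟩ := hy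
  obtain ⟨U, hU, hUε⟩ := hy3.smallOscAt hε
  have hyG : G ∈ 𝓝 y := hGo.mem_nhds ⟨hy1 hyA, hy2⟩
  refine hosc ⟨V ×ˢ (U ∩ G), prod_mem_nhds (hV.mem_nhds ht) (inter_mem hU hyG), ?_⟩
  rintro ⟨s, u⟩ ⟨hs, hu, huG⟩ ⟨s', u'⟩ ⟨hs', hu', hu'G⟩
  have h1 := hGA s hs t₀ ht₀ u huG
  have h2 := hGA t₀ ht₀ s hs u huG
  have h3 := hGA s' hs' t₀ ht₀ u' hu'G
  have h4 := hGA t₀ ht₀ s' hs' u' hu'G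
  have h5 := abs_le.1 (hUε u hu u' hu')
  simp only at h5
  rw [abs_le]
  constructor <;> linarith [h5.1, h5.2]

lemma exists_cover_not_continuousAt [TopologicalSpace.MetrizableSpace T]
    [TopologicalSpace.MetrizableSpace Y] {f : T × Y → ℝ}
    (hf : ∀ y, Continuous fun t => f (t, y))
    (hcont : ∀ t, IsMeagre {y | ¬ ContinuousAt (fun y => f (t, y)) y})
    (hext : ∀ s t, BoundExtends fun y => f (s, y) - f (t, y)) :
    ∃ K : ℕ → Set (T × Y), (∀ m, IsClosed (K m)) ∧
      (∀ m p, ∃ U ∈ 𝓝 p, IsNowhereDense (Prod.snd '' (K m ∩ U))) ∧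
      {p | ¬ ContinuousAt f p} ⊆ ⋃ m, K m := by
  obtain ⟨C, V, hCc, hCf, hVo, hCV, hbase⟩ := exists_locallyFinite_closed_covers T
  choose N hNc hNd hN using fun (m j : ℕ) (c : T) =>
    (isMeagre_not_smallOscAt_of_sections hcont hext (hVo j c)
      (Nat.one_div_pos_of_nat (α := ℝ) (n := m))).exists_isClosed_isNowhereDense
  let K : ℕ × ℕ × ℕ → Set (T × Y) := fun q => ⋃ c, C q.2.1 c ×ˢ N q.1 q.2.1 c q.2.2
  have hlf : ∀ j, LocallyFinite fun c => (Prod.fst ⁻¹' C j c : Set (T × Y)) := fun j =>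
    (hCf j).preimage_continuous continuous_fst
  have hKc : ∀ q, IsClosed (K q) := fun q =>
    ((hlf q.2.1).subset fun c p hp => hp.1).isClosed_iUnion fun c => (hCc _ _).prod (hNc _ _ _ _)
  have hKd : ∀ q p, ∃ U ∈ 𝓝 p, IsNowhereDense (Prod.snd '' (K q ∩ U)) := by
    intro q p
    obtain ⟨U, hU, hfin⟩ := hlf q.2.1 p
    refine ⟨U, hU, (hfin.isNowhereDense_biUnion fun c _ => hNd q.1 q.2.1 c q.2.2).mono ?_⟩
    rintro _ ⟨x, ⟨hx, hxU⟩, rfl⟩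
    obtain ⟨c, hxC, hxN⟩ := mem_iUnion.1 hx
    exact mem_biUnion (show c ∈ {c | (Prod.fst ⁻¹' C q.2.1 c ∩ U).Nonempty} from
      ⟨x, hxC, hxU⟩) hxN
  obtain ⟨e, he⟩ := exists_surjective_nat (ℕ × ℕ × ℕ)
  refine ⟨fun m => K (e m), fun m => hKc _, fun m => hKd _, ?_⟩
  rintro ⟨t, y⟩ hp
  obtain ⟨m, hm⟩ := exists_not_smallOscAt hp (c := 4) (by norm_num)
  have hε : (0 : ℝ) < 1 / ((m : ℝ) + 1) := Nat.one_div_pos_of_nat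
  obtain ⟨U, hU, hUε⟩ := (hf y).continuousAt.smallOscAt (x := t) hε
  obtain ⟨j, c, htC, hVU⟩ := hbase t U hU
  obtain ⟨i, hi⟩ := mem_iUnion.1 (hN m j c ⟨fun s hs s' hs' =>
    (le_abs_self _).trans (hUε s (hVU hs) s' (hVU hs')), t, hCV j c htC, hm⟩)
  obtain ⟨k, hk⟩ := he (m, j, i)
  refine mem_iUnion.2 ⟨k, ?_⟩
  simp only [hk]
  exact mem_iUnion.2 ⟨c, htC, hi⟩

lemma isMeagre_not_continuousAt_of_sections [TopologicalSpace.MetrizableSpace T]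
    [TopologicalSpace.MetrizableSpace Y] {f : T × Y → ℝ}
    (hf : ∀ y, Continuous fun t => f (t, y))
    (hcont : ∀ t, IsMeagre {y | ¬ ContinuousAt (fun y => f (t, y)) y})
    (hext : ∀ s t, BoundExtends fun y => f (s, y) - f (t, y)) :
    IsMeagre {p | ¬ ContinuousAt f p} := by
  obtain ⟨K, hKc, hKd, hK⟩ := exists_cover_not_continuousAt hf hcont hext
  refine (isMeagre_iUnion fun m => ((hKc m).isNowhereDense_of_local fun p => ?_).isMeagre).mono hK
  obtain ⟨U, hU, h⟩ := hKd m p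
  exact ⟨U, hU, (h.preimage_of_isOpenMap continuous_snd isOpenMap_snd).mono
    (subset_preimage_image _ _)⟩

end Product

section Pi

variable {ι : Type*} [DecidableEq ι] {X : ι → Type*}

lemma Homeomorph.piSplitAt_symm_update_fst [∀ i, TopologicalSpace (X i)] (k : ι) (s t : X k)
    (y : ∀ j : {j // j ≠ k}, X j) :
    Function.update ((Homeomorph.piSplitAt k X).symm (s, y)) k t =
      (Homeomorph.piSplitAt k X).symm (t, y) := by
  ext i
  rcases eq_or_ne i k with rfl | hi
  · simp [Homeomorph.piSplitAt]
  · simp [Homeomorph.piSplitAt, hi]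

lemma Homeomorph.piSplitAt_symm_update_snd [∀ i, TopologicalSpace (X i)] (k : ι) (t : X k)
    (y : ∀ j : {j // j ≠ k}, X j) (j : {j // j ≠ k}) (s : X j) :
    (Homeomorph.piSplitAt k X).symm (t, Function.update y j s) =
      Function.update ((Homeomorph.piSplitAt k X).symm (t, y)) j s := by
  ext i
  rcases eq_or_ne i k with rfl | hi
  · simp [Homeomorph.piSplitAt, j.2.symm]
  · rcases eq_or_ne i j with rfl | hij
    · simp [Homeomorph.piSplitAt, hi]
    · have : (⟨i, hi⟩ : {j // j ≠ k}) ≠ j := fun h => hij (congrArg Subtype.val h)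
      simp [Homeomorph.piSplitAt, hi, hij, this]

/-- Separate continuity on a product indexed by an arbitrary type. -/
def PiSeparatelyContinuous [∀ i, TopologicalSpace (X i)] (f : (∀ i, X i) → ℝ) : Prop :=
  ∀ (k : ι) (x : ∀ i, X i), Continuous fun t : X k => f (Function.update x k t)

namespace PiSeparatelyContinuous

variable [∀ i, TopologicalSpace (X i)] {f g : (∀ i, X i) → ℝ}

lemma neg (hf : PiSeparatelyContinuous f) : PiSeparatelyContinuous fun x => -f x :=
  fun k x => (hf k x).neg

lemma sub (hf : PiSeparatelyContinuous f) (hg : PiSeparatelyContinuous g) :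
    PiSeparatelyContinuous fun x => f x - g x :=
  fun k x => (hf k x).sub (hg k x)

lemma continuous_section (hf : PiSeparatelyContinuous f) (k : ι) (y : ∀ j : {j // j ≠ k}, X j) :
    Continuous fun t => f ((Homeomorph.piSplitAt k X).symm (t, y)) := by
  rw [continuous_iff_continuousAt]
  intro t
  simpa only [Homeomorph.piSplitAt_symm_update_fst] using
    (hf k ((Homeomorph.piSplitAt k X).symm (t, y))).continuousAt (x := t)

lemma hyperplane_section (hf : PiSeparatelyContinuous f) (k : ι) (t : X k) :
    PiSeparatelyContinuous fun y => f ((Homeomorph.piSplitAt k X).symm (t, y)) := by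
  intro j y
  simp only [Homeomorph.piSplitAt_symm_update_snd]
  exact hf j _

end PiSeparatelyContinuous

end Pi

theorem PiSeparatelyContinuous.boundExtends {ι : Type*} [DecidableEq ι] [Finite ι] {X : ι → Type*}
    [∀ i, TopologicalSpace (X i)] [∀ i, FirstCountableTopology (X i)] {f : (∀ i, X i) → ℝ}
    (hf : PiSeparatelyContinuous f) : BoundExtends f := by
  induction h : Nat.card ι generalizing ι with
  | zero =>
    have : IsEmpty ι := (Nat.card_eq_zero.1 h).resolve_right (not_infinite_iff_finite.2 ‹_›)
    intro G _ _ a hGa y hy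
    obtain ⟨z, hz⟩ := closure_nonempty_iff.1 ⟨y, hGa hy⟩
    rwa [Subsingleton.elim y z]
  | succ n ih =>
    have : Nonempty ι := (Nat.card_pos_iff.1 (h ▸ n.succ_pos)).1
    obtain ⟨k⟩ := this
    have hcard : Nat.card {j // j ≠ k} = n := by
      have := Fintype.ofFinite ι
      rw [Nat.card_eq_fintype_card] at h ⊢
      simp [Fintype.card_subtype_compl, h]
    set e := Homeomorph.piSplitAt k X with he
    have hfe : BoundExtends (f ∘ e.symm) := .of_sections (fun y => hf.continuous_section k y)
      (fun t => ih (hf.hyperplane_section k t) hcard)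
      (fun t => ih (hf.hyperplane_section k t).neg hcard)
    simpa [Function.comp_assoc] using hfe.comp_homeomorph e

theorem PiSeparatelyContinuous.isMeagre_not_continuousAt {ι : Type*} [DecidableEq ι] [Finite ι]
    {X : ι → Type*} [∀ i, TopologicalSpace (X i)] [∀ i, TopologicalSpace.MetrizableSpace (X i)]
    {f : (∀ i, X i) → ℝ} (hf : PiSeparatelyContinuous f) :
    IsMeagre {x | ¬ ContinuousAt f x} := by
  induction h : Nat.card ι generalizing ι with
  | zero =>
    have : IsEmpty ι := (Nat.card_eq_zero.1 h).resolve_right (not_infinite_iff_finite.2 ‹_›)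
    have hc : Continuous f := continuous_of_const fun x y => by rw [Subsingleton.elim x y]
    simpa [hc.continuousAt] using IsMeagre.empty
  | succ n ih =>
    have : Nonempty ι := (Nat.card_pos_iff.1 (h ▸ n.succ_pos)).1
    obtain ⟨k⟩ := this
    have := Fintype.ofFinite ι
    have hcard : Nat.card {j // j ≠ k} = n := by
      rw [Nat.card_eq_fintype_card] at h ⊢
      simp [Fintype.card_subtype_compl, h]
    set e := Homeomorph.piSplitAt k X with he
    have hm : IsMeagre {p | ¬ ContinuousAt (f ∘ e.symm) p} :=
      isMeagre_not_continuousAt_of_sections (fun y => hf.continuous_section k y)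
        (fun t => ih (hf.hyperplane_section k t) hcard)
        (fun s t => ((hf.hyperplane_section k s).sub (hf.hyperplane_section k t)).boundExtends)
    refine (hm.preimage_of_isOpenMap e.continuous e.isOpenMap).mono fun x hx => ?_
    rw [mem_preimage, mem_ofPred_eq, e.symm.comp_continuousAt_iff']
    simpa using hx

/-- The discontinuity set of a separately continuous function is covered by countably many closed
sets which are locally projectively nowhere dense with respect to a given variable. -/
lemma SeparatelyContinuous.exists_cover {n : ℕ} {X : Fin n → Type*} [∀ i, TopologicalSpace (X i)]
    [∀ i, TopologicalSpace.MetrizableSpace (X i)] {f : (∀ i, X i) → ℝ}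
    (hf : SeparatelyContinuous f) (k : Fin n) :
    ∃ K : ℕ → Set (∀ i, X i), (∀ m, IsClosed (K m)) ∧
      (∀ m, LocallyProjectivelyNowhereDenseWrt k (K m)) ∧ {x | ¬ ContinuousAt f x} ⊆ ⋃ m, K m := by
  have hf' : PiSeparatelyContinuous f := hf
  set e := Homeomorph.piSplitAt k X with he
  obtain ⟨K, hKc, hKd, hK⟩ := exists_cover_not_continuousAt (f := f ∘ e.symm)
    (fun y => hf'.continuous_section k y)
    (fun t => (hf'.hyperplane_section k t).isMeagre_not_continuousAt)
    (fun s t => ((hf'.hyperplane_section k s).sub (hf'.hyperplane_section k t)).boundExtends)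
  refine ⟨fun m => e ⁻¹' K m, fun m => (hKc m).preimage e.continuous, fun m x => ?_, fun x hx => ?_⟩
  · obtain ⟨U, hU, h⟩ := hKd m (e x)
    refine ⟨e ⁻¹' U, e.continuous.continuousAt hU, h.mono ?_⟩
    rintro _ ⟨z, hz, rfl⟩
    exact ⟨e z, hz, rfl⟩
  · rw [← preimage_iUnion]
    refine hK ?_
    rw [mem_ofPred_eq, e.symm.comp_continuousAt_iff']
    simpa using hx

theorem discontinuity_set_necessity
    {n : ℕ} {X : Fin n → Type*} [∀ i, TopologicalSpace (X i)]
    [∀ i, TopologicalSpace.MetrizableSpace (X i)]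
    (f : (∀ i, X i) → ℝ) (hf : SeparatelyContinuous f) :
    ∃ E : ℕ → Set (∀ i, X i),
      (∀ m, IsFsigma (E m) ∧ LocallyProjectivelyMeager (E m)) ∧
      {x | ¬ ContinuousAt f x} = ⋃ m, E m := by
  choose K hKc hKd hK using hf.exists_cover
  let E : ℕ × (Fin n → ℕ) → Set (∀ i, X i) := fun q =>
    {x | ¬ SmallOscAt f (1 * (1 / ((q.1 : ℝ) + 1))) x} ∩ ⋂ k, K k (q.2 k)
  obtain ⟨e, he⟩ := exists_surjective_nat (ℕ × (Fin n → ℕ))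
  refine ⟨fun m => E (e m), fun m => ⟨⟨fun _ => E (e m), fun _ => ?_, (iUnion_const _).symm⟩,
    fun k x => ?_⟩, subset_antisymm (fun x hx => ?_) (iUnion_subset fun m x hx hc => ?_)⟩
  · exact (isClosed_not_smallOscAt _ _).inter (isClosed_iInter fun k => hKc k _)
  · obtain ⟨U, hU, h⟩ := hKd k ((e m).2 k) x
    exact ⟨U, hU, h.isMeagre.mono
      (image_mono (inter_subset_inter_left _ fun z hz => mem_iInter.1 hz.2 k))⟩
  · obtain ⟨m, hm⟩ := exists_not_smallOscAt hx one_pos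
    choose i hi using fun k => mem_iUnion.1 (hK k hx)
    obtain ⟨j, hj⟩ := he (m, i)
    refine mem_iUnion.2 ⟨j, ?_⟩
    simp only [hj]
    exact ⟨hm, mem_iInter.2 hi⟩
  · exact hx.1 (hc.smallOscAt (mul_pos one_pos Nat.one_div_pos_of_nat))
end

section
/- Let X₁, …, X_n be metrizable topological spaces, X = X₁ × ⋯ × X_n, and let E ⊆ X be an F_σ set that is locally projectively meager. Then E can be represented as the union of a sequence of closed sets each of which is locally projectively nowhere dense. -/
/-- A meagre set is covered by a sequence of closed nowhere dense sets. -/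
theorem IsMeagre.exists_seq_isClosed_isNowhereDense {Y : Type*} [TopologicalSpace Y] {A : Set Y}
    (hA : IsMeagre A) :
    ∃ N : ℕ → Set Y, (∀ j, IsClosed (N j) ∧ IsNowhereDense (N j)) ∧ A ⊆ ⋃ j, N j := by
  obtain ⟨S, hS, hSc, hAS⟩ := isMeagre_iff_countable_union_isNowhereDense.1 hA
  obtain ⟨f, hf⟩ := (hSc.insert ∅).exists_eq_range (Set.insert_nonempty _ _)
  have hnd (j : ℕ) : IsNowhereDense (f j) := by
    have hj : f j ∈ insert ∅ S := hf ▸ Set.mem_range_self j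
    rcases hj with hj | hj
    · exact hj ▸ isNowhereDense_empty
    · exact hS _ hj
  refine ⟨fun j => closure (f j), fun j => ⟨isClosed_closure, (hnd j).closure⟩, fun a ha => ?_⟩
  obtain ⟨t, ht, hat⟩ := hAS ha
  obtain ⟨j, rfl⟩ : t ∈ Set.range f := hf ▸ Set.mem_insert_of_mem _ ht
  exact Set.mem_iUnion.2 ⟨j, subset_closure hat⟩

theorem IsNowhereDense.union_s9 {Y : Type*} [TopologicalSpace Y] {A B : Set Y}
    (hA : IsNowhereDense A) (hB : IsNowhereDense B) : IsNowhereDense (A ∪ B) := by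
  rw [IsNowhereDense, closure_union]
  exact (interior_union_isClosed_of_interior_empty isClosed_closure hB).trans hA

theorem Set.Finite.isNowhereDense_biUnion_s9 {Y ι : Type*} [TopologicalSpace Y] {s : Set ι}
    (hs : s.Finite) {N : ι → Set Y} (hN : ∀ i ∈ s, IsNowhereDense (N i)) :
    IsNowhereDense (⋃ i ∈ s, N i) := by
  induction s, hs using Set.Finite.induction_on with
  | empty => simp
  | insert _ _ ih =>
    rw [Set.biUnion_insert]
    exact (hN _ (Set.mem_insert _ _)).union_s9 (ih fun i hi => hN i (Set.mem_insert_of_mem _ hi))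

theorem continuous_projHat {n : ℕ} {X : Fin n → Type*} [∀ i, TopologicalSpace (X i)] (k : Fin n) :
    Continuous (projHat (X := X) k) :=
  continuous_pi fun i => continuous_apply i.1

theorem fsigma_locallyProjMeager_eq_union_closed_locallyProjNwd
    {n : ℕ} {X : Fin n → Type*} [∀ i, TopologicalSpace (X i)]
    [∀ i, TopologicalSpace.MetrizableSpace (X i)]
    (E : Set (∀ i, X i)) (hE : IsFsigma E) (hEm : LocallyProjectivelyMeager E) :
    ∃ F : ℕ → Set (∀ i, X i),
      (∀ j, IsClosed (F j) ∧ LocallyProjectivelyNowhereDense (F j)) ∧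
      E = ⋃ j, F j := by
  let := TopologicalSpace.metrizableSpaceMetric (∀ i, X i)
  have : ParacompactSpace (∀ i, X i) := inferInstance
  obtain ⟨G, hG, rfl⟩ := hE
  choose U hU hUm using fun (x : ∀ i, X i) (k : Fin n) => hEm k x
  obtain ⟨v, hvo, hvc, hvf, hvU⟩ := precise_refinement
    (fun x => interior (⋂ k, U x k)) (fun _ => isOpen_interior)
    (Set.iUnion_eq_univ_iff.2 fun x => ⟨x, mem_interior_iff_mem_nhds.2 <|
      Filter.iInter_mem.2 fun k => hU x k⟩)
  obtain ⟨C, hCc, hCcl, hCv⟩ := exists_iUnion_eq_closed_subset hvo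
    (fun x => hvf.point_finite x) hvc
  have hCf : LocallyFinite C := hvf.subset hCv
  have hCU (x : ∀ i, X i) (k : Fin n) : C x ⊆ U x k :=
    (hCv x).trans <| (hvU x).trans <| interior_subset.trans <| Set.iInter_subset _ k
  choose N hN hUN using fun x k => (hUm x k).exists_seq_isClosed_isNowhereDense
  let F (p : ℕ × (Fin n → ℕ)) : Set (∀ i, X i) :=
    ⋃ x, G p.1 ∩ (C x ∩ ⋂ k, projHat k ⁻¹' N x k (p.2 k))
  have hF (p) : IsClosed (F p) ∧ LocallyProjectivelyNowhereDense (F p) := by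
    refine ⟨LocallyFinite.isClosed_iUnion
      (hCf.subset fun x => Set.inter_subset_right.trans Set.inter_subset_left) fun x =>
      (hG _).inter <| (hCcl x).inter <| isClosed_iInter fun k =>
        (hN x k _).1.preimage (continuous_projHat k), fun k x => ?_⟩
    obtain ⟨V, hV, hVf⟩ := hCf x
    refine ⟨V, hV, (hVf.isNowhereDense_biUnion_s9
      (N := fun y => N y k (p.2 k)) fun y _ => (hN y k _).2).mono ?_⟩
    rintro _ ⟨z, ⟨hz, hzV⟩, rfl⟩
    obtain ⟨y, -, hzC, hzN⟩ := Set.mem_iUnion.1 hz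
    exact Set.mem_biUnion ⟨z, hzC, hzV⟩ (Set.mem_iInter.1 hzN k)
  obtain ⟨e, he⟩ := exists_surjective_nat (ℕ × (Fin n → ℕ))
  refine ⟨F ∘ e, fun j => hF (e j), Set.Subset.antisymm (fun z hz => ?_) ?_⟩
  · obtain ⟨m, hm⟩ := Set.mem_iUnion.1 hz
    obtain ⟨x, hx⟩ := Set.iUnion_eq_univ_iff.1 hCc z
    have hzN (k : Fin n) : ∃ j, projHat k z ∈ N x k j :=
      Set.mem_iUnion.1 <| hUN x k ⟨z, ⟨hz, hCU x k hx⟩, rfl⟩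
    choose j hj using hzN
    obtain ⟨i, hi⟩ := he (m, j)
    refine Set.mem_iUnion.2 ⟨i, ?_⟩
    rw [Function.comp_apply, hi]
    exact Set.mem_iUnion.2 ⟨x, hm, hx, Set.mem_iInter.2 hj⟩
  · exact Set.iUnion_subset fun i => Set.iUnion_subset fun x =>
      Set.inter_subset_left.trans (Set.subset_iUnion G _)
end
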